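/- arXiv:2509.20137 — 3 statements merged into one kernel-verified Lean document; each statement's English description precedes it below -/
import Mathlib

section
/- Let 𝒜 be a Frobenius abelian category. Then for every object M of 𝒜, either qpd_𝒜(M) = 0 or qpd_𝒜(M) = ∞. -/
/-!
Quasi-projective dimension, following Gheibi–Jorgensen–Takahashi and
Chen–Chen–Liu, "Properties of quasi-projective dimension over abelian categories".
-/

open CategoryTheory CategoryTheory.Limits

attribute [local instance] CategoryTheory.Abelian.hasFiniteBiproducts

noncomputable section

universe v u

namespace QPD

variable {A : Type*} [Category A] [Abelian A]

/-- The direct sum of `n` copies of `M`. -/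
def copies (M : A) (n : ℕ) : A := ⨁ (fun _ : Fin n => M)

/-- `X` belongs to `add M`: it is a direct summand of a finite direct sum of copies of `M`. -/
def inAdd (M X : A) : Prop :=
  ∃ (n : ℕ) (s : X ⟶ copies M n) (r : copies M n ⟶ X), s ≫ r = 𝟙 X

/-- `P` is a quasi-projective resolution of `M`: a bounded-below complex of projective
objects whose `j`-th homology is a direct sum of `mult j` copies of `M`, where the
multiplicities `mult j` are not all zero. -/
structure IsQuasiProjRes (M : A) (P : ChainComplex A ℤ) : Prop where
  projective : ∀ i, Projective (P.X i)
  bddBelow : ∃ a : ℤ, ∀ i, i < a → IsZero (P.X i)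
  homology_iso : ∃ mult : ℤ → ℕ, (∃ j, mult j ≠ 0) ∧
    ∀ j, Nonempty (P.homology j ≅ copies M (mult j))

/-- `P` is a finite (i.e. bounded) quasi-projective resolution of `M`. -/
structure IsFiniteQuasiProjRes (M : A) (P : ChainComplex A ℤ) extends
    IsQuasiProjRes M P : Prop where
  bddAbove : ∃ b : ℤ, ∀ i, b < i → IsZero (P.X i)

/-- `s` is the supremum of the degrees in which `P` is nonzero. -/
def IsSup (P : ChainComplex A ℤ) (s : ℤ) : Prop :=
  ¬ IsZero (P.X s) ∧ ∀ i, s < i → IsZero (P.X i)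

/-- `t` is the supremum of the degrees in which the homology of `P` is nonzero. -/
def IsHSup (P : ChainComplex A ℤ) (t : ℤ) : Prop :=
  ¬ IsZero (P.homology t) ∧ ∀ i, t < i → IsZero (P.homology i)

/-- `t` is the infimum of the degrees in which the homology of `P` is nonzero. -/
def IsHInf (P : ChainComplex A ℤ) (t : ℤ) : Prop :=
  ¬ IsZero (P.homology t) ∧ ∀ i, i < t → IsZero (P.homology i)

open Classical in
/-- The quasi-projective dimension of `M`, as an element of `ℕ∞`: the infimum of
`sup P• - hsup P•` over all finite quasi-projective resolutions `P•` of `M`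
(it is `0` for the zero object and `⊤` if no finite quasi-projective resolution exists). -/
def qpd (M : A) : ℕ∞ :=
  if IsZero M then 0
  else sInf {d : ℕ∞ | ∃ (P : ChainComplex A ℤ) (s t : ℤ),
    IsFiniteQuasiProjRes M P ∧ IsSup P s ∧ IsHSup P t ∧ d = ((s - t).toNat : ℕ∞)}

/-- `M` admits a projective resolution of length at most `n`. -/
def pdLE (M : A) (n : ℕ) : Prop :=
  ∃ P : ChainComplex A ℤ, (∀ i, Projective (P.X i)) ∧
    (∀ i : ℤ, i < 0 → IsZero (P.X i)) ∧ (∀ i : ℤ, (n : ℤ) < i → IsZero (P.X i)) ∧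
    (∀ i : ℤ, i ≠ 0 → IsZero (P.homology i)) ∧ Nonempty (P.homology 0 ≅ M)

/-- The projective dimension of `M`, as an element of `ℕ∞`. -/
def pd (M : A) : ℕ∞ := sInf {d : ℕ∞ | ∃ n : ℕ, d = (n : ℕ∞) ∧ pdLE M n}

open Classical in
/-- Quasi-projective dimension computed using only complexes all of whose terms satisfy the
predicate `Q` (e.g. `Q` = "finitely generated", for the category of finitely presented
modules over a left coherent ring). -/
def qpdRel (Q : A → Prop) (M : A) : ℕ∞ :=
  if IsZero M then 0
  else sInf {d : ℕ∞ | ∃ (P : ChainComplex A ℤ) (s t : ℤ),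
    IsFiniteQuasiProjRes M P ∧ (∀ i, Q (P.X i)) ∧ IsSup P s ∧ IsHSup P t ∧
    d = ((s - t).toNat : ℕ∞)}

/-- Projective dimension computed using only resolutions all of whose terms satisfy the
predicate `Q`. -/
def pdRel (Q : A → Prop) (M : A) : ℕ∞ :=
  sInf {d : ℕ∞ | ∃ n : ℕ, d = (n : ℕ∞) ∧ ∃ P : ChainComplex A ℤ,
    (∀ i, Projective (P.X i)) ∧ (∀ i, Q (P.X i)) ∧
    (∀ i : ℤ, i < 0 → IsZero (P.X i)) ∧ (∀ i : ℤ, (n : ℤ) < i → IsZero (P.X i)) ∧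
    (∀ i : ℤ, i ≠ 0 → IsZero (P.homology i)) ∧ Nonempty (P.homology 0 ≅ M)}

/-- Vanishing of the `n`-th Ext group, `Ext_𝒜^n(M, N) = 0`. -/
def extIsZero [EnoughProjectives A] (M N : A) (n : ℕ) : Prop :=
  IsZero (((_root_.Ext ℤ A n).obj (Opposite.op M)).obj N)

/-- The quasi-projective dimension of a finitely presented module over a (left coherent)
ring, computed inside the abelian category of finitely presented modules, i.e. via bounded
complexes of finitely generated projective modules. -/
def qpdFG {R : Type u} [Ring R] (M : ModuleCat.{u} R) : ℕ∞ :=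
  qpdRel (fun N : ModuleCat.{u} R => Module.Finite R N) M

/-- The projective dimension of a finitely presented module over a (left coherent) ring,
computed inside the abelian category of finitely presented modules. -/
def pdFG {R : Type u} [Ring R] (M : ModuleCat.{u} R) : ℕ∞ :=
  pdRel (fun N : ModuleCat.{u} R => Module.Finite R N) M

/-- A ring is left coherent if every finitely generated left ideal is finitely presented. -/
def IsLeftCoherent (R : Type u) [Ring R] : Prop :=
  ∀ I : Ideal R, I.FG → Module.FinitePresentation R I

/-- The quasi-global dimension of a ring: the supremum of the quasi-projective dimensions
of all finitely generated left modules. -/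
def qgldim (R : Type u) [Ring R] : ℕ∞ :=
  sSup {d : ℕ∞ | ∃ M : ModuleCat.{u} R, Module.Finite R M ∧ d = qpd M}

/-- The global dimension of a ring: the supremum of the projective dimensions of all
finitely generated left modules. -/
def gldim (R : Type u) [Ring R] : ℕ∞ :=
  sSup {d : ℕ∞ | ∃ M : ModuleCat.{u} R, Module.Finite R M ∧ d = pd M}

/-- The finitistic dimension of a ring: the supremum of the projective dimensions of all
finitely generated left modules of finite projective dimension. -/
def findim (R : Type u) [Ring R] : ℕ∞ :=
  sSup {d : ℕ∞ | ∃ M : ModuleCat.{u} R, Module.Finite R M ∧ d = pd M ∧ pd M ≠ ⊤}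

/-- The depth of a module over a Noetherian local ring:
`depth M = inf {i : Ext^i(R/𝔪, M) ≠ 0}`. -/
def depth {R : Type u} [CommRing R] [IsLocalRing R] (M : ModuleCat.{u} R) : ℕ∞ :=
  sInf {d : ℕ∞ | ∃ n : ℕ, d = (n : ℕ∞) ∧
    ¬ IsZero (((_root_.Ext ℤ (ModuleCat.{u} R) n).obj
      (Opposite.op (ModuleCat.of R (IsLocalRing.ResidueField R)))).obj M)}

end QPD

end

namespace QPD

open ComplexShape

/-- The embedding of `up ℕ` in `down ℤ` which sends `n : ℕ` to `t - n`. -/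
def embeddingDownIntLE (t : ℤ) : (up ℕ).Embedding (down ℤ) :=
  Embedding.mk' _ _ (fun n => t - n)
    (fun _ _ h => by dsimp at h; lia)
    (fun _ _ => by simp only [up_Rel, down_Rel]; lia)

lemma embeddingDownIntLE_f (t : ℤ) (n : ℕ) : (embeddingDownIntLE t).f n = t - n := rfl

instance (t : ℤ) : (embeddingDownIntLE t).IsTruncGE where
  rel' _ _ h := by
    simp only [embeddingDownIntLE_f, up_Rel, down_Rel] at h ⊢
    lia
  mem_next {j _} h := ⟨j + 1, by
    simp only [embeddingDownIntLE_f, down_Rel] at h ⊢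
    push_cast
    lia⟩

lemma embeddingDownIntLE_f_ne {t i : ℤ} (hi : t < i) (n : ℕ) :
    (embeddingDownIntLE t).f n ≠ i := by
  rw [embeddingDownIntLE_f]
  lia

lemma embeddingDownIntLE_f_toNat {t i : ℤ} (hi : i ≤ t) :
    (embeddingDownIntLE t).f (t - i).toNat = i := by
  rw [embeddingDownIntLE_f]
  lia

lemma mono_fromOpcycles_of_isZero_homology {A : Type*} [Category A] [Abelian A]
    (P : ChainComplex A ℤ) (i j : ℤ) (hij : (down ℤ).next i = j) (h : IsZero (P.homology i)) :
    Mono (P.fromOpcycles i j) :=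
  Preadditive.mono_of_isZero_kernel' _ (P.homologyIsKernel i j hij) h

/-- If `P` is exact in degree `i` and the opcycles in degree `i` are injective, then the
opcycles in degree `i - 1` are a direct summand of the term in degree `i - 1`. -/
lemma nonempty_retract_opcycles {A : Type*} [Category A] [Abelian A]
    (P : ChainComplex A ℤ) (i j : ℤ) (hij : (down ℤ).Rel i j)
    (h : IsZero (P.homology i)) [Injective (P.opcycles i)] :
    Nonempty (Retract (P.opcycles j) (P.X j)) := by
  have : Mono (P.fromOpcycles i j) :=
    mono_fromOpcycles_of_isZero_homology P i j ((down ℤ).next_eq' hij) h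
  let r : P.X j ⟶ P.opcycles i := Injective.factorThru (𝟙 _) (P.fromOpcycles i j)
  have hr : P.fromOpcycles i j ≫ r = 𝟙 _ := Injective.comp_factorThru _ _
  have hz : P.fromOpcycles i j ≫ P.pOpcycles j = 0 := by
    rw [← cancel_epi (P.pOpcycles i), P.p_fromOpcycles_assoc, P.d_pOpcycles, comp_zero]
  refine ⟨⟨P.descOpcycles (𝟙 _ - r ≫ P.fromOpcycles i j) i ((down ℤ).prev_eq' hij) ?_,
    P.pOpcycles j, ?_⟩⟩
  · rw [← P.p_fromOpcycles, Category.assoc, Preadditive.comp_sub, reassoc_of% hr,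
      Category.comp_id, sub_self, comp_zero]
  · rw [← cancel_epi (P.pOpcycles j), P.p_descOpcycles_assoc, Preadditive.sub_comp,
      Category.assoc, hz, comp_zero, sub_zero, Category.id_comp, Category.comp_id]

/-- For a complex of injective objects which is bounded above, the opcycles are injective in
all degrees from the supremum of the homology on. -/
lemma injective_opcycles {A : Type*} [Category A] [Abelian A] (P : ChainComplex A ℤ)
    [∀ i, Injective (P.X i)] {b t : ℤ} (hb : ∀ i, b < i → IsZero (P.X i))
    (ht : ∀ i, t < i → IsZero (P.homology i)) (i : ℤ) (hi : t ≤ i) :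
    Injective (P.opcycles i) := by
  obtain ⟨n, hn⟩ : ∃ n : ℕ, b < i + n := ⟨(b + 1 - i).toNat, by lia⟩
  induction n generalizing i with
  | zero => exact ((hb i (by simpa using hn)).of_epi (P.pOpcycles i)).injective
  | succ n ih =>
    have := ih (i + 1) (by lia) (by push_cast at hn; lia)
    obtain ⟨r⟩ := nonempty_retract_opcycles P (i + 1) i rfl (ht _ (by lia))
    exact r.injective

lemma quasiIso_πTruncGE_embeddingDownIntLE {A : Type*} [Category A] [Abelian A]
    (P : ChainComplex A ℤ) {t : ℤ} (ht : ∀ i, t < i → IsZero (P.homology i)) :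
    QuasiIso (P.πTruncGE (embeddingDownIntLE t)) := by
  refine (P.quasiIso_πTruncGE_iff_isSupported _).2 ⟨fun i hi => ?_⟩
  rw [P.exactAt_iff_isZero_homology]
  refine ht i ?_
  by_contra! h
  exact hi _ (embeddingDownIntLE_f_toNat h)

/-- The truncation of a finite quasi-projective resolution at the supremum `t` of its homology
is a finite quasi-projective resolution, provided the opcycles in degree `t` are projective. -/
lemma IsFiniteQuasiProjRes.truncGE {A : Type*} [Category A] [Abelian A] {M : A}
    {P : ChainComplex A ℤ} (hP : IsFiniteQuasiProjRes M P) {t : ℤ}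
    (ht : ∀ i, t < i → IsZero (P.homology i)) (hproj : Projective (P.opcycles t)) :
    IsFiniteQuasiProjRes M (P.truncGE (embeddingDownIntLE t)) := by
  set e := embeddingDownIntLE t
  have hzero (i : ℤ) (hi : t < i) : IsZero ((P.truncGE e).X i) :=
    (P.truncGE e).isZero_X_of_isStrictlySupported e i (embeddingDownIntLE_f_ne hi)
  have : QuasiIso (P.πTruncGE e) := quasiIso_πTruncGE_embeddingDownIntLE P ht
  refine ⟨⟨fun i => ?_, ?_, ?_⟩, ⟨t, hzero⟩⟩
  · rcases le_or_gt i t with hi | hi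
    · have he := embeddingDownIntLE_f_toNat hi
      by_cases hb : e.BoundaryGE (t - i).toNat
      · obtain rfl : i = t := by
          by_contra hne
          exact hb.notMem (i' := i + 1) (by rw [he]; rfl) _
            (embeddingDownIntLE_f_toNat (by lia))
        exact Projective.of_iso (P.truncGEXIsoOpcycles e he hb).symm hproj
      · exact Projective.of_iso (P.truncGEXIso e he hb).symm (hP.projective i)
    · exact (hzero i hi).projective
  · obtain ⟨a, ha⟩ := hP.bddBelow
    exact ⟨a, fun i hi => (ha i hi).of_epi ((P.πTruncGE e).f i)⟩
  · obtain ⟨mult, hmult, hiso⟩ := hP.homology_iso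
    exact ⟨mult, hmult, fun j =>
      ⟨(isoOfQuasiIsoAt (P.πTruncGE e) j).symm ≪≫ (hiso j).some⟩⟩

end QPD

open QPD in
/-- In a Frobenius abelian category every object has quasi-projective
dimension `0` or `∞`. -/
theorem qpd_eq_zero_or_top_of_frobenius {A : Type*} [Category A] [Abelian A]
    [EnoughProjectives A] [EnoughInjectives A]
    (hfrob : ∀ X : A, Projective X ↔ Injective X) (M : A) :
    qpd M = 0 ∨ qpd M = ⊤ := by
  by_cases hM : IsZero M
  · exact Or.inl (if_pos hM)
  by_cases hex : ∃ P : ChainComplex A ℤ, IsFiniteQuasiProjRes M P ∧ ∃ t, IsHSup P t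
  · left
    obtain ⟨P, hP, t, ht⟩ := hex
    have (i : ℤ) : Injective (P.X i) := (hfrob _).1 (hP.projective i)
    obtain ⟨b, hb⟩ := hP.bddAbove
    have hQ := hP.truncGE ht.2 ((hfrob _).2 (injective_opcycles P hb ht.2 t le_rfl))
    have hXzero (i : ℤ) (hi : t < i) :
        IsZero ((P.truncGE (embeddingDownIntLE t)).X i) :=
      HomologicalComplex.isZero_X_of_isStrictlySupported _ (embeddingDownIntLE t) i
        (embeddingDownIntLE_f_ne hi)
    have := quasiIso_πTruncGE_embeddingDownIntLE P ht.2
    have hhom : ¬ IsZero ((P.truncGE (embeddingDownIntLE t)).homology t) := fun h =>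
      ht.1 (h.of_iso (isoOfQuasiIsoAt (P.πTruncGE (embeddingDownIntLE t)) t))
    have hzero {i : ℤ} (h : IsZero ((P.truncGE (embeddingDownIntLE t)).X i)) :
        IsZero ((P.truncGE (embeddingDownIntLE t)).homology i) :=
      (HomologicalComplex.exactAt_iff_isZero_homology _ _).1
        (HomologicalComplex.ExactAt.of_isZero h)
    rw [qpd, if_neg hM, ← nonpos_iff_eq_zero]
    exact sInf_le ⟨_, t, t, hQ, ⟨fun h => hhom (hzero h), hXzero⟩,
      ⟨hhom, fun i hi => hzero (hXzero i hi)⟩, by simp⟩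
  · right
    rw [qpd, if_neg hM, sInf_eq_top]
    rintro _ ⟨P, _, t, hP, _, ht, _⟩
    exact (hex ⟨P, hP, t, ht⟩).elim
end

section
/- Let 𝒜 be an abelian category with enough projective objects, let k ≥ 0 be an integer, and let M be an object of 𝒜 with Ext_𝒜^n(M, M) = 0 for all integers n with 2 ≤ n ≤ k + 1. Suppose X• is an object of the bounded derived category D^b(𝒜) such that H_i(X•) ∈ add(M) for 0 ≤ i ≤ k and H_i(X•) = 0 for i > k or i < 0. Then X• ≅ ⨁_{i=0}^{k} H_i(X•)[i] in D^b(𝒜). -/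
/-!
Quasi-projective dimension, following Gheibi–Jorgensen–Takahashi and
Chen–Chen–Liu, "Properties of quasi-projective dimension over abelian categories".
-/

open CategoryTheory CategoryTheory.Limits

attribute [local instance] CategoryTheory.Abelian.hasFiniteBiproducts

namespace DerivedCategory

open Pretriangulated Abelian

variable {C : Type*} [Category C] [Abelian C] [HasDerivedCategory C]

lemma isIso_homologyMap_mor₁_of_isGE {T : Triangle (DerivedCategory C)}
    (hT : T ∈ distTriang (DerivedCategory C)) {n : ℤ}
    (h₃ : T.obj₃.IsGE n) {i : ℤ} (hi : i < n) :
    IsIso ((homologyFunctor C i).map T.mor₁) := by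
  have : Mono ((homologyFunctor C i).map T.mor₁) :=
    (HomologySequence.mono_homologyMap_mor₁_iff T hT (i - 1) i).2
      ((isZero_of_isGE T.obj₃ n (i - 1) (by lia)).eq_of_src _ _)
  have : Epi ((homologyFunctor C i).map T.mor₁) :=
    (HomologySequence.epi_homologyMap_mor₁_iff T hT i).2
      ((isZero_of_isGE T.obj₃ n i hi).eq_of_tgt _ _)
  exact isIso_of_mono_of_epi _

lemma isIso_homologyMap_mor₂_of_isLE {T : Triangle (DerivedCategory C)}
    (hT : T ∈ distTriang (DerivedCategory C)) {n : ℤ}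
    (h₁ : T.obj₁.IsLE n) {i : ℤ} (hi : n < i) :
    IsIso ((homologyFunctor C i).map T.mor₂) := by
  have : Mono ((homologyFunctor C i).map T.mor₂) :=
    (HomologySequence.mono_homologyMap_mor₂_iff T hT i).2
      ((isZero_of_isLE T.obj₁ n i hi).eq_of_src _ _)
  have : Epi ((homologyFunctor C i).map T.mor₂) :=
    (HomologySequence.epi_homologyMap_mor₂_iff T hT i (i + 1)).2
      ((isZero_of_isLE T.obj₁ n (i + 1) (by lia)).eq_of_tgt _ _)
  exact isIso_of_mono_of_epi _

lemma exists_iso_singleFunctor_homology (X : DerivedCategory C) (n : ℤ) [X.IsGE n] [X.IsLE n] :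
    Nonempty (X ≅ (singleFunctor C n).obj ((homologyFunctor C n).obj X)) := by
  obtain ⟨Y, ⟨e⟩⟩ := X.exists_iso_singleFunctor_obj_of_isGE_of_isLE n
  exact ⟨e ≪≫ (singleFunctor C n).mapIso
    (((singleFunctorCompHomologyFunctorIso C n).app Y).symm ≪≫
      (homologyFunctor C n).mapIso e.symm)⟩

/-- Truncation triangle, with its effect on homology. -/
lemma exists_truncation_triangle (X : DerivedCategory C) (a b : ℤ) (h : a + 1 = b) :
    ∃ (X₁ X₃ : DerivedCategory C) (f : X₁ ⟶ X) (g : X ⟶ X₃) (δ : X₃ ⟶ X₁⟦(1 : ℤ)⟧),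
      Triangle.mk f g δ ∈ distTriang (DerivedCategory C) ∧ X₁.IsLE a ∧ X₃.IsGE b ∧
      (∀ i ≤ a, IsIso ((homologyFunctor C i).map f)) ∧
      (∀ i, b ≤ i → IsIso ((homologyFunctor C i).map g)) := by
  obtain ⟨X₁, X₃, h₁, h₃, f, g, δ, hT⟩ := TStructure.t.exists_triangle X a b h
  exact ⟨X₁, X₃, f, g, δ, hT, ⟨h₁⟩, ⟨h₃⟩,
    fun i hi ↦ isIso_homologyMap_mor₁_of_isGE hT (n := b) ⟨h₃⟩ (by lia),
    fun i hi ↦ isIso_homologyMap_mor₂_of_isLE hT (n := a) ⟨h₁⟩ (by lia)⟩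

lemma exists_toSingle_of_isLE (X : DerivedCategory C) (n : ℤ) [X.IsLE n] :
    ∃ f : X ⟶ (singleFunctor C n).obj ((homologyFunctor C n).obj X),
      IsIso ((homologyFunctor C n).map f) := by
  obtain ⟨X₁, X₃, f, g, δ, hT, h₁, h₃, hf, hg⟩ := X.exists_truncation_triangle (n - 1) n (by lia)
  have : X₃.IsLE n := (isLE_iff _ _).2 fun i hi ↦ by
    have := hg i hi.le
    exact (X.isZero_of_isLE n i hi).of_iso (asIso ((homologyFunctor C i).map g)).symm
  obtain ⟨e⟩ := X₃.exists_iso_singleFunctor_homology n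
  have := hg n le_rfl
  refine ⟨g ≫ e.hom ≫ (singleFunctor C n).map (inv ((homologyFunctor C n).map g)), ?_⟩
  simp only [Functor.map_comp]
  infer_instance

/-- If `Y` has homology concentrated in degrees `a, …, b` and satisfying `P`, and objects
satisfying `P` placed in these degrees have no nonzero maps to `Z`, then every morphism
`Y ⟶ Z` vanishes. -/
lemma hom_eq_zero_of_homology (P : ObjectProperty C) [P.IsClosedUnderIsomorphisms]
    (Z : DerivedCategory C) (a : ℤ) (m : ℕ) (Y : DerivedCategory C) (b : ℤ) (hb : b + 1 = a + m)
    (hYa : Y.IsGE a) (hYb : Y.IsLE b)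
    (hY : ∀ i, a ≤ i → i ≤ b → P ((homologyFunctor C i).obj Y))
    (hZ : ∀ i, a ≤ i → i ≤ b → ∀ B, P B → ∀ g : (singleFunctor C i).obj B ⟶ Z, g = 0)
    (f : Y ⟶ Z) : f = 0 := by
  induction m generalizing Y b with
  | zero => exact (TStructure.t.isZero Y b a (by lia)).eq_of_src _ _
  | succ m ih =>
    obtain ⟨Y₁, Y₃, u, v, δ, hT, h₁, h₃, hu, hv⟩ := Y.exists_truncation_triangle (b - 1) b (by lia)
    have h₁' : Y₁.IsGE a := (isGE_iff _ _).2 fun i hi ↦ by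
      have := hu i (by lia)
      exact (Y.isZero_of_isGE a i hi).of_iso (asIso ((homologyFunctor C i).map u))
    have h₃' : Y₃.IsLE b := (isLE_iff _ _).2 fun i hi ↦ by
      have := hv i hi.le
      exact (Y.isZero_of_isLE b i hi).of_iso (asIso ((homologyFunctor C i).map v)).symm
    have huf : u ≫ f = 0 := ih Y₁ (b - 1) (by lia) h₁' h₁
      (fun i hi hi' ↦ by
        have := hu i hi'
        exact P.prop_of_iso (asIso ((homologyFunctor C i).map u)).symm (hY i hi (by lia)))
      (fun i hi hi' ↦ hZ i hi (by lia)) _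
    obtain ⟨g, rfl⟩ : ∃ g : Y₃ ⟶ Z, f = v ≫ g := Triangle.yoneda_exact₂ _ hT f huf
    obtain ⟨e⟩ := Y₃.exists_iso_singleFunctor_homology b
    have := hv b le_rfl
    have hg := hZ b (by lia) le_rfl _
      (P.prop_of_iso (asIso ((homologyFunctor C b).map v)) (hY b (by lia) le_rfl)) (e.inv ≫ g)
    rw [Iso.inv_comp_eq, comp_zero] at hg
    rw [hg, comp_zero]

lemma hom_singleFunctor_eq_zero [HasExt C] {B B' : C} {p : ℕ} (h : Subsingleton (Ext B B' p))
    {i j : ℤ} (hij : j + p = i)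
    (f : (singleFunctor C i).obj B ⟶ (singleFunctor C j).obj B') : f = 0 := by
  have : Subsingleton
      (ShiftedHom ((singleFunctor C 0).obj B) ((singleFunctor C 0).obj B') (p : ℤ)) :=
    Ext.homEquiv.symm.subsingleton
  apply (shiftFunctor (DerivedCategory C) i).map_injective
  rw [Functor.map_zero, ← cancel_epi (((singleFunctors C).shiftIso i 0 i (by lia)).inv.app B),
    ← cancel_mono (((singleFunctors C).shiftIso i (-p) j (by lia)).hom.app B'),
    ← cancel_mono (((singleFunctors C).shiftIso p (-p) 0 (by lia)).inv.app B')]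
  exact this.elim _ _

/-- If `X` is bounded above by `b`, its homology in degrees `n, …, b` satisfies `P`, and there
are no nonzero maps from objects satisfying `P` placed in degrees `n + 1, …, b` to objects
satisfying `P` placed in degree `n - 1`, then the `n`-th homology of `X` can be realised by a
morphism from `X` to a single object. -/
lemma exists_toSingle (P : ObjectProperty C) [P.IsClosedUnderIsomorphisms]
    (X : DerivedCategory C) (n b : ℤ) (hn : n ≤ b) [X.IsLE b]
    (hX : ∀ i, n ≤ i → i ≤ b → P ((homologyFunctor C i).obj X))
    (hP : ∀ i, n < i → i ≤ b → ∀ B B', P B → P B' →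
      ∀ g : (singleFunctor C i).obj B ⟶ (singleFunctor C (n - 1)).obj B', g = 0) :
    ∃ f : X ⟶ (singleFunctor C n).obj ((homologyFunctor C n).obj X),
      IsIso ((homologyFunctor C n).map f) := by
  obtain ⟨X₁, X₃, u, v, δ, hT, h₁, h₃, hu, hv⟩ := X.exists_truncation_triangle n (n + 1) rfl
  obtain ⟨q, hq⟩ := X₁.exists_toSingle_of_isLE n
  have := hu n le_rfl
  have h₃' : X₃.IsLE b := (isLE_iff _ _).2 fun i hi ↦ by
    have := hv i (by lia)
    exact (X.isZero_of_isLE b i hi).of_iso (asIso ((homologyFunctor C i).map v)).symm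
  have hδ : δ ≫ q⟦(1 : ℤ)⟧' = 0 := by
    rw [← cancel_mono (((singleFunctors C).shiftIso 1 (n - 1) n (by lia)).hom.app _), zero_comp]
    refine hom_eq_zero_of_homology P _ (n + 1) (b - n).toNat X₃ b (by lia) h₃ h₃' ?_ ?_ _
    · intro i hi hi'
      have := hv i hi
      exact P.prop_of_iso (asIso ((homologyFunctor C i).map v)) (hX i (by lia) hi')
    · exact fun i hi hi' B hB ↦ hP i (by lia) hi' B _ hB
        (P.prop_of_iso (asIso ((homologyFunctor C n).map u)).symm (hX n le_rfl hn))
  obtain ⟨f, hf⟩ : ∃ f : X ⟶ _, q = u ≫ f := by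
    obtain ⟨g, hg⟩ : ∃ g : X⟦(1 : ℤ)⟧ ⟶ _, q⟦(1 : ℤ)⟧' = (-u⟦(1 : ℤ)⟧') ≫ g :=
      Triangle.yoneda_exact₂ _ (rot_of_distTriang _ (rot_of_distTriang _ hT)) (q⟦(1 : ℤ)⟧') hδ
    refine ⟨-(shiftFunctor (DerivedCategory C) (1 : ℤ)).preimage g,
      (shiftFunctor (DerivedCategory C) (1 : ℤ)).map_injective ?_⟩
    rw [hg, Functor.map_comp, Functor.map_neg, Functor.map_preimage, Preadditive.neg_comp,
      Preadditive.comp_neg]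
  refine ⟨f ≫ (singleFunctor C n).map ((homologyFunctor C n).map u), ?_⟩
  rw [hf, Functor.map_comp] at hq
  have : IsIso ((homologyFunctor C n).map f) :=
    IsIso.of_isIso_comp_left ((homologyFunctor C n).map u) _
  rw [Functor.map_comp]
  infer_instance

end DerivedCategory

section

variable {C : Type*} [Category C] [Abelian C]

/-- Vanishing of `Ext` computed from projective resolutions implies vanishing of the `Ext` groups
defined through the derived category. -/
lemma CategoryTheory.Abelian.Ext.subsingleton_of_isZero_Ext [EnoughProjectives C] [HasExt C]
    {X Y : C} {n : ℕ} (hn : 1 ≤ n) (h : IsZero (((_root_.Ext ℤ C n).obj (Opposite.op X)).obj Y)) :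
    Subsingleton (Abelian.Ext X Y n) := by
  let R := projectiveResolution X
  obtain ⟨p, rfl⟩ : ∃ p, n = p + 1 := ⟨n - 1, by lia⟩
  refine subsingleton_of_forall_eq 0 fun α ↦ ?_
  obtain ⟨f, hf, rfl⟩ := R.extMk_surjective α _ rfl
  rw [R.extMk_eq_zero_iff _ _ _ _ p rfl]
  have hK : (R.complex.linearYonedaObj ℤ Y).ExactAt (p + 1) := by
    rw [HomologicalComplex.exactAt_iff_isZero_homology]
    exact h.of_iso (R.isoExt (p + 1) Y).symm
  rw [HomologicalComplex.exactAt_iff' _ p (p + 1) (p + 2) (by simp) (by simp),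
    ShortComplex.moduleCat_exact_iff] at hK
  obtain ⟨g, hg⟩ := hK f hf
  exact ⟨g, hg⟩

lemma HomologicalComplex.homologyMap_eq_zero_of_f_eq_zero {K L : CochainComplex C ℤ} (f : K ⟶ L)
    (n : ℤ) (h : f.f n = 0) :
    HomologicalComplex.homologyMap f n = 0 := by
  rw [← cancel_epi (K.homologyπ n), ← cancel_mono (L.homologyι n)]
  simp [h]

lemma CochainComplex.exists_single_hom_isIso_homologyMap (K : CochainComplex C ℤ)
    (hK : ∀ i j, K.d i j = 0) (n : ℤ) :
    ∃ f : (HomologicalComplex.single C (.up ℤ) n).obj (K.X n) ⟶ K,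
      IsIso (HomologicalComplex.homologyMap f n) := by
  let i : (HomologicalComplex.single C (.up ℤ) n).obj (K.X n) ⟶ K :=
    HomologicalComplex.mkHomFromSingle (𝟙 _) (by simp [hK])
  let p : K ⟶ (HomologicalComplex.single C (.up ℤ) n).obj (K.X n) :=
    HomologicalComplex.mkHomToSingle (𝟙 _) (by simp [hK])
  have hip : i ≫ p = 𝟙 _ := HomologicalComplex.from_single_hom_ext (by simp [i, p])
  refine ⟨i, ⟨HomologicalComplex.homologyMap p n, ?_, ?_⟩⟩
  · rw [← HomologicalComplex.homologyMap_comp, hip, HomologicalComplex.homologyMap_id]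
  · rw [← HomologicalComplex.homologyMap_comp, ← HomologicalComplex.homologyMap_id, ← sub_eq_zero,
      ← HomologicalComplex.homologyMap_sub]
    exact HomologicalComplex.homologyMap_eq_zero_of_f_eq_zero _ _ (by simp [i, p])

end

namespace DerivedCategory

open Abelian

variable {C : Type*} [Category C] [Abelian C] [HasDerivedCategory C]

lemma exists_fromSingle (K : CochainComplex C ℤ) (hK : ∀ i j, K.d i j = 0) (n : ℤ) :
    ∃ f : (singleFunctor C n).obj (K.X n) ⟶ Q.obj K, IsIso ((homologyFunctor C n).map f) := by
  obtain ⟨f, hf⟩ := CochainComplex.exists_single_hom_isIso_homologyMap K hK n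
  have : IsIso ((homologyFunctor C n).map (Q.map f)) :=
    (NatIso.isIso_map_iff (homologyFunctorFactors C n) f).2 hf
  refine ⟨(singleFunctorIsoCompQ C n).hom.app _ ≫ Q.map f, ?_⟩
  rw [Functor.map_comp]
  exact IsIso.comp_isIso' inferInstance this

lemma isZero_homology_single (B : C) {m n : ℤ} (h : m ≠ n) :
    IsZero ((homologyFunctor C m).obj ((singleFunctor C n).obj B)) := by
  rcases h.lt_or_gt with h | h
  · exact isZero_of_isGE _ n m h
  · exact isZero_of_isLE _ n m h

/-- Let `K` be a bounded complex with zero differentials. If the homology of `X` is realised by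
morphisms from `X` to the objects `K.X i` placed in degree `i`, then `X` is isomorphic to `K` in
the derived category. -/
lemma nonempty_iso_of_toSingle (X : DerivedCategory C) (s : Finset ℤ)
    (hs : ∀ i ∉ s, IsZero ((homologyFunctor C i).obj X))
    (K : CochainComplex C ℤ) (hK : ∀ i j, K.d i j = 0) (hK' : ∀ i ∉ s, IsZero (K.X i))
    (hX : ∀ i ∈ s, ∃ f : X ⟶ (singleFunctor C i).obj (K.X i),
      IsIso ((homologyFunctor C i).map f)) :
    Nonempty (X ≅ Q.obj K) := by
  choose g hg using exists_fromSingle K hK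
  choose! f hf using hX
  let φ : X ⟶ Q.obj K := ∑ i ∈ s, f i ≫ g i
  have hφ : IsIso φ := by
    refine (isIso_iff C φ).2 fun m ↦ ?_
    by_cases hm : m ∈ s
    · have : (homologyFunctor C m).map φ =
          (homologyFunctor C m).map (f m) ≫ (homologyFunctor C m).map (g m) := by
        rw [Functor.map_sum, Finset.sum_eq_single_of_mem m hm, Functor.map_comp]
        intro i _ hi
        rw [Functor.map_comp, (isZero_homology_single (K.X i) hi.symm).eq_of_tgt
          ((homologyFunctor C m).map (f i)) 0, zero_comp]
      rw [this]
      have := hf m hm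
      infer_instance
    · have : IsZero ((homologyFunctor C m).obj (Q.obj K)) := by
        refine IsZero.of_iso ?_ ((homologyFunctorFactors C m).app K)
        exact ShortComplex.isZero_homology_of_isZero_X₂ _ (hK' m hm)
      exact (hs m hm).isIso this _
  exact ⟨asIso φ⟩

end DerivedCategory

namespace QPD

variable {A : Type*} [Category A] [Abelian A]

instance (M : A) : ObjectProperty.IsClosedUnderIsomorphisms (inAdd M : ObjectProperty A) where
  of_iso := fun e ⟨n, s, r, h⟩ ↦ ⟨n, e.inv ≫ s, r ≫ e.hom, by simp [reassoc_of% h]⟩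

lemma inAdd.exists_sum_eq_id {M B : A} (hB : inAdd M B) :
    ∃ (n : ℕ) (a : Fin n → (B ⟶ M)) (b : Fin n → (M ⟶ B)), ∑ j, a j ≫ b j = 𝟙 B := by
  obtain ⟨n, s, r, h⟩ := hB
  obtain ⟨π, ι, hπ⟩ : ∃ (π : Fin n → (copies M n ⟶ M)) (ι : Fin n → (M ⟶ copies M n)),
      ∑ j, π j ≫ ι j = 𝟙 (copies M n) :=
    ⟨biproduct.π fun _ ↦ M, biproduct.ι fun _ ↦ M, biproduct.total⟩
  refine ⟨n, fun j ↦ s ≫ π j, fun j ↦ ι j ≫ r, ?_⟩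
  calc ∑ j, (s ≫ π j) ≫ ι j ≫ r = s ≫ (∑ j, π j ≫ ι j) ≫ r := by
        simp only [Preadditive.sum_comp, Preadditive.comp_sum, Category.assoc]
    _ = 𝟙 B := by rw [hπ, Category.id_comp, h]

/-- Vanishing of all morphisms `F M ⟶ G M` extends to `add M`, for additive `F` and `G`. -/
lemma hom_eq_zero_of_inAdd {D : Type*} [Category D] [Preadditive D] (F G : A ⥤ D)
    [F.Additive] [G.Additive] {M B B' : A} (hB : inAdd M B) (hB' : inAdd M B')
    (hM : ∀ f : F.obj M ⟶ G.obj M, f = 0) (f : F.obj B ⟶ G.obj B') : f = 0 := by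
  obtain ⟨n, a, b, h⟩ := hB.exists_sum_eq_id
  obtain ⟨n', a', b', h'⟩ := hB'.exists_sum_eq_id
  rw [← Category.id_comp f, ← Category.comp_id f, ← F.map_id, ← G.map_id, ← h, ← h',
    F.map_sum, G.map_sum, Preadditive.sum_comp]
  refine Finset.sum_eq_zero fun j _ ↦ ?_
  rw [Preadditive.comp_sum, Preadditive.comp_sum]
  refine Finset.sum_eq_zero fun j' _ ↦ ?_
  have := hM (F.map (b j) ≫ f ≫ G.map (a' j'))
  simp only [Functor.map_comp, Category.assoc]
  rw [reassoc_of% this, zero_comp, comp_zero]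

end QPD

open QPD in
/-- If `Ext^n(M, M) = 0` for `2 ≤ n ≤ k + 1` and `X` is an object of the
(bounded) derived category whose homology is concentrated in (homological) degrees
`0, …, k` and lies in `add M`, then `X` is isomorphic to the direct sum of its shifted
homology objects, i.e. to the complex with the same homology and zero differentials.
(We use cohomological conventions: homological degree `i` is cohomological degree `-i`.) -/
theorem derived_decomposition_of_ext_vanishing {A : Type*} [Category A] [Abelian A]
    [EnoughProjectives A] [HasDerivedCategory A]
    (k : ℕ) (M : A)
    (hext : ∀ n : ℕ, 2 ≤ n → n ≤ k + 1 → extIsZero M M n)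
    (X : DerivedCategory A)
    (hX : ∀ i : ℤ, -(k : ℤ) ≤ i → i ≤ 0 →
      inAdd M ((DerivedCategory.homologyFunctor A i).obj X))
    (hX' : ∀ i : ℤ, (i < -(k : ℤ) ∨ 0 < i) →
      IsZero ((DerivedCategory.homologyFunctor A i).obj X)) :
    Nonempty (X ≅ DerivedCategory.Q.obj
      { X := fun i => (DerivedCategory.homologyFunctor A i).obj X
        d := fun _ _ => 0
        shape := fun _ _ _ => rfl
        d_comp_d' := fun _ _ _ _ _ => by simp }) := by
  have := hasExt_of_hasDerivedCategory A
  have : X.IsLE 0 := (DerivedCategory.isLE_iff _ _).2 fun i hi ↦ hX' i (.inr hi)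
  have h₀ (i : ℤ) (hi : i ∉ Finset.Icc (-(k : ℤ)) 0) :
      IsZero ((DerivedCategory.homologyFunctor A i).obj X) :=
    hX' i (by rw [Finset.mem_Icc] at hi; lia)
  refine X.nonempty_iso_of_toSingle (Finset.Icc (-(k : ℤ)) 0) h₀ _ (fun _ _ ↦ rfl) h₀
    fun n hn ↦ ?_
  rw [Finset.mem_Icc] at hn
  refine X.exists_toSingle (inAdd M) n 0 hn.2 (fun i hi ↦ hX i (by lia)) ?_
  intro i hi hi' B B' hB hB'
  refine hom_eq_zero_of_inAdd _ _ hB hB' fun f ↦ ?_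
  obtain ⟨p, hp⟩ : ∃ p : ℕ, n - 1 + p = i := ⟨(i - (n - 1)).toNat, by lia⟩
  exact DerivedCategory.hom_singleFunctor_eq_zero
    (CategoryTheory.Abelian.Ext.subsingleton_of_isZero_Ext (by lia) (hext p (by lia) (by lia))) hp f
end

section
/- Let R be a quasi-Frobenius ring and let M be a left R-module with qpd_R(M) < ∞. If Ext_R^n(M, M) = 0 for all integers n ≥ 2, then M is projective. -/
/-!
Quasi-projective dimension, following Gheibi–Jorgensen–Takahashi and
Chen–Chen–Liu, "Properties of quasi-projective dimension over abelian categories".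
-/

open CategoryTheory CategoryTheory.Limits

attribute [local instance] CategoryTheory.Abelian.hasFiniteBiproducts

namespace QPD

variable {A : Type*} [Category A] [Abelian A]

/-- Every `(n + 1)`-cocycle of `Hom(Q, N)` is a coboundary. If `Q` is a projective resolution
of `M`, this says that `Ext^(n + 1)(M, N) = 0`. -/
def CocyclesExtend (Q : ChainComplex A ℕ) (N : A) (n : ℕ) : Prop :=
  ∀ f : Q.X (n + 1) ⟶ N, Q.d (n + 2) (n + 1) ≫ f = 0 →
    ∃ g : Q.X n ⟶ N, Q.d (n + 1) n ≫ g = f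

lemma cocyclesExtend_of_extIsZero [EnoughProjectives A] {M N : A} (Q : ProjectiveResolution M)
    {n : ℕ} (h : extIsZero M N (n + 1)) : CocyclesExtend Q.complex N n := by
  intro f hf
  have h₁ := IsZero.of_iso h (Q.isoExt (R := ℤ) (n + 1) N).symm
  rw [← HomologicalComplex.exactAt_iff_isZero_homology,
    HomologicalComplex.exactAt_iff' _ n (n + 1) (n + 2) (by simp) (by simp),
    ShortComplex.moduleCat_exact_iff] at h₁
  exact h₁ f hf

namespace CocyclesExtend

variable {Q : ChainComplex A ℕ} {n : ℕ}

lemma of_isZero {N : A} (hN : IsZero N) : CocyclesExtend Q N n :=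
  fun _ _ => ⟨0, hN.eq_of_tgt _ _⟩

lemma of_iso {N N' : A} (e : N ≅ N') (h : CocyclesExtend Q N n) : CocyclesExtend Q N' n := by
  intro f hf
  obtain ⟨g, hg⟩ := h (f ≫ e.inv) (by rw [reassoc_of% hf, zero_comp])
  exact ⟨g ≫ e.hom, by simp [reassoc_of% hg]⟩

lemma biproduct {N : A} (h : CocyclesExtend Q N n) (k : ℕ) :
    CocyclesExtend Q (⨁ fun _ : Fin k => N) n := by
  intro f hf
  choose g hg using fun j : Fin k =>
    h (f ≫ Limits.biproduct.π (fun _ : Fin k => N) j) (by rw [reassoc_of% hf, zero_comp])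
  refine ⟨Limits.biproduct.lift g, Limits.biproduct.hom_ext _ _ fun j => ?_⟩
  rw [Category.assoc, Limits.biproduct.lift_π, hg]

lemma middle [∀ i, Projective (Q.X i)] {S : ShortComplex A} (hS : S.ShortExact)
    (h₁ : CocyclesExtend Q S.X₁ n) (h₃ : CocyclesExtend Q S.X₃ n) :
    CocyclesExtend Q S.X₂ n := by
  intro f hf
  have := hS.mono_f
  have := hS.epi_g
  obtain ⟨g, hg⟩ := h₃ (f ≫ S.g) (by rw [reassoc_of% hf, zero_comp])
  obtain ⟨k, hk⟩ := hS.exact.lift' (f - Q.d (n + 1) n ≫ Projective.factorThru g S.g) (by simp [hg])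
  obtain ⟨l, hl⟩ := h₁ k (by rw [← cancel_mono S.f]; simp [hk, hf])
  refine ⟨l ≫ S.f + Projective.factorThru g S.g, ?_⟩
  rw [Preadditive.comp_add, reassoc_of% hl, hk, sub_add_cancel]

lemma right [∀ i, Projective (Q.X i)] (hQ : Q.ExactAt (n + 1))
    {S : ShortComplex A} (hS : S.ShortExact) [Injective S.X₂]
    (h : CocyclesExtend Q S.X₁ (n + 1)) : CocyclesExtend Q S.X₃ n := by
  intro f hf
  have := hS.mono_f
  have := hS.epi_g
  obtain ⟨k, hk⟩ := hS.exact.lift' (Q.d (n + 2) (n + 1) ≫ Projective.factorThru f S.g)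
    (by simp [hf])
  obtain ⟨l, hl⟩ := h k (by rw [← cancel_mono S.f]; simp [hk])
  rw [HomologicalComplex.exactAt_iff' _ (n + 2) (n + 1) n (by simp) (by simp)] at hQ
  have hc : Q.d (n + 2) (n + 1) ≫ (Projective.factorThru f S.g - l ≫ S.f) = 0 := by
    rw [Preadditive.comp_sub, reassoc_of% hl, hk, sub_self]
  obtain ⟨g, hg⟩ : ∃ g : Q.X n ⟶ S.X₂,
      Q.d (n + 1) n ≫ g = Projective.factorThru f S.g - l ≫ S.f :=
    ⟨hQ.descToInjective _ hc, hQ.comp_descToInjective _ hc⟩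
  exact ⟨g ≫ S.g, by simp [reassoc_of% hg]⟩

/-- If `Ext^1(M, S.X₁) = 0`, morphisms from `M` lift along the epimorphism of a short exact
sequence `S`. -/
lemma exists_lift {M : A} (Q : ProjectiveResolution M) {S : ShortComplex A} (hS : S.ShortExact)
    (h : CocyclesExtend Q.complex S.X₁ 0) (f : M ⟶ S.X₃) : ∃ g : M ⟶ S.X₂, g ≫ S.g = f := by
  have := hS.mono_f
  have := hS.epi_g
  let p : Q.complex.X 0 ⟶ M := Q.π.f 0
  have hp : Q.complex.d 1 0 ≫ p = 0 := Q.complex_d_comp_π_f_zero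
  have : Epi p := inferInstanceAs (Epi (Q.π.f 0))
  let e := Projective.factorThru (p ≫ f) S.g
  have he : e ≫ S.g = p ≫ f := Projective.factorThru_comp _ _
  obtain ⟨k, hk⟩ := hS.exact.lift' (Q.complex.d 1 0 ≫ e) (by simp [he, reassoc_of% hp])
  obtain ⟨l, hl⟩ := h k (by rw [← cancel_mono S.f]; simp [hk])
  obtain ⟨g, hg⟩ : ∃ g : M ⟶ S.X₂, p ≫ g = e - l ≫ S.f :=
    ⟨Q.exact₀.desc (e - l ≫ S.f) (by simp [reassoc_of% hl, hk]), Q.exact₀.g_desc _ _⟩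
  exact ⟨g, by rw [← cancel_epi p, reassoc_of% hg]; simp [he]⟩

end CocyclesExtend

/-- The object of boundaries of a complex in degree `i`. -/
noncomputable abbrev boundaries (P : ChainComplex A ℤ) (i : ℤ) : A := kernel (P.homologyπ i)

/-- The sequence `0 ⟶ B_i ⟶ Z_i ⟶ H_i ⟶ 0`. -/
noncomputable abbrev boundariesCyclesHomology (P : ChainComplex A ℤ) (i : ℤ) : ShortComplex A :=
  ShortComplex.mk (kernel.ι (P.homologyπ i)) (P.homologyπ i) (kernel.condition _)

lemma boundariesCyclesHomology_shortExact (P : ChainComplex A ℤ) (i : ℤ) :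
    (boundariesCyclesHomology P i).ShortExact where
  exact := ShortComplex.exact_kernel _

/-- The sequence `0 ⟶ Z_j ⟶ P_j ⟶ B_i ⟶ 0`, of interest for `j = i + 1`. -/
noncomputable abbrev cyclesXBoundaries (P : ChainComplex A ℤ) (j i : ℤ) : ShortComplex A :=
  ShortComplex.mk (P.iCycles j)
    (kernel.lift (P.homologyπ i) (P.toCycles j i) (P.toCycles_comp_homologyπ j i))
    (by rw [← cancel_mono (kernel.ι _), ← cancel_mono (P.iCycles i)]; simp)

lemma cyclesXBoundaries_shortExact (P : ChainComplex A ℤ) {i j : ℤ} (hij : i + 1 = j) :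
    (cyclesXBoundaries P j i).ShortExact where
  exact := by
    refine ShortComplex.exact_of_f_is_kernel _ ?_
    refine KernelFork.IsLimit.ofι _ _
      (fun k hk => P.liftCycles k i (by simp [← hij]) ?_) (fun k hk => by simp)
      (fun k hk m hm => by rw [← cancel_mono (P.iCycles j)]; simpa using hm)
    have := hk =≫ (kernel.ι _ ≫ P.iCycles i)
    simpa using this
  epi_g := by
    have h : (ShortComplex.mk _ _ (P.toCycles_comp_homologyπ j i)).Exact :=
      ShortComplex.exact_of_g_is_cokernel _ (P.homologyIsCokernel j i (by simp [← hij]))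
    exact h.epi_kernelLift

section

variable {M : A} {P : ChainComplex A ℤ} (Q : ProjectiveResolution M)

lemma cocyclesExtend_boundaries (hM : ∀ n, CocyclesExtend Q.complex M (n + 1))
    (hP : ∀ i, Injective (P.X i)) {b : ℤ} (hb : ∀ i, b < i → IsZero (P.X i))
    (hH : ∀ i, ∃ k, Nonempty (P.homology i ≅ ⨁ fun _ : Fin k => M)) (i : ℤ) (n : ℕ) :
    CocyclesExtend Q.complex (boundaries P i) n := by
  obtain ⟨m, hm⟩ : ∃ m : ℕ, b < i + m := ⟨(b - i + 1).toNat, by lia⟩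
  induction m generalizing i n with
  | zero =>
    refine .of_isZero (IsZero.of_mono (kernel.ι (P.homologyπ i)) ?_)
    exact IsZero.of_mono (P.iCycles i) (hb i (by simpa using hm))
  | succ m ih =>
    have := hP (i + 1)
    obtain ⟨k, ⟨e⟩⟩ := hH (i + 1)
    exact .right (Q.complex_exactAt_succ n) (cyclesXBoundaries_shortExact P rfl)
      (.middle (boundariesCyclesHomology_shortExact P (i + 1))
        (ih (i + 1) (n + 1) (by push_cast at hm; lia)) (((hM n).biproduct k).of_iso e.symm))

/-- If `Ext^1(M, B_i) = 0` for all `i`, a bounded below complex of projectives whose homology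
objects are direct sums of copies of `M` has projective homology. -/
lemma projective_homology (hP : ∀ i, Projective (P.X i)) {a : ℤ}
    (ha : ∀ i, i < a → IsZero (P.X i))
    (hH : ∀ i, ∃ k, Nonempty (P.homology i ≅ ⨁ fun _ : Fin k => M))
    (hB : ∀ i, CocyclesExtend Q.complex (boundaries P i) 0) (i : ℤ) :
    Projective (P.homology i) := by
  have splitting (i : ℤ) : Nonempty (boundariesCyclesHomology P i).Splitting := by
    obtain ⟨k, ⟨e⟩⟩ := hH i
    have hS := boundariesCyclesHomology_shortExact P i
    choose s hs using fun j : Fin k => (hB i).exists_lift Q hS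
      (biproduct.ι (fun _ : Fin k => M) j ≫ e.inv)
    refine ⟨.ofExactOfSection _ hS.exact (e.hom ≫ biproduct.desc s) ?_ hS.mono_f⟩
    have : biproduct.desc s ≫ (boundariesCyclesHomology P i).g = e.inv :=
      biproduct.hom_ext' _ _ fun j => by rw [biproduct.ι_desc_assoc, hs]
    rw [Category.assoc, this, e.hom_inv_id]
  suffices h : Projective (P.cycles i) by
    obtain ⟨σ⟩ := splitting i
    exact Retract.projective (Y := P.cycles i) ⟨σ.s, P.homologyπ i, σ.s_g⟩
  obtain ⟨m, hm⟩ : ∃ m : ℕ, i < a + m := ⟨(i - a + 1).toNat, by lia⟩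
  induction m generalizing i with
  | zero =>
    have hZ : IsZero (P.cycles i) := IsZero.of_mono (P.iCycles i) (ha i (by simpa using hm))
    exact Projective.of_iso hZ.isoZero.symm inferInstance
  | succ m ih =>
    obtain ⟨j, rfl⟩ : ∃ j, i = j + 1 := ⟨i - 1, by lia⟩
    have := ih j (by push_cast at hm; lia)
    obtain ⟨σ⟩ := splitting j
    have : Projective (boundaries P j) :=
      Retract.projective (Y := P.cycles j) ⟨kernel.ι (P.homologyπ j), σ.r, σ.f_r⟩
    have hS := cyclesXBoundaries_shortExact P (rfl : j + 1 = j + 1)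
    have := hS.epi_g
    let τ := ShortComplex.Splitting.ofExactOfSection _ hS.exact
      (Projective.factorThru (𝟙 _) (cyclesXBoundaries P (j + 1) j).g)
      (Projective.factorThru_comp _ _) hS.mono_f
    have := hP (j + 1)
    exact Retract.projective (Y := P.X (j + 1)) ⟨P.iCycles (j + 1), τ.r, τ.f_r⟩

end

lemma exists_isFiniteQuasiProjRes_of_qpd_lt_top {M : A} (hM : ¬ IsZero M) (h : qpd M < ⊤) :
    ∃ P : ChainComplex A ℤ, IsFiniteQuasiProjRes M P := by
  rw [qpd, if_neg hM, sInf_lt_iff] at h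
  obtain ⟨_, ⟨P, _, _, hP, _⟩, _⟩ := h
  exact ⟨P, hP⟩

end QPD

open QPD in
/-- Over a quasi-Frobenius ring, a module of finite quasi-projective
dimension with `Ext^n(M, M) = 0` for all `n ≥ 2` is projective. -/
theorem projective_of_qpd_lt_top_of_quasiFrobenius {R : Type u} [Ring R]
    (hQF : ∀ M : ModuleCat.{u} R, Projective M ↔ Injective M)
    (M : ModuleCat.{u} R) (hq : qpd M < ⊤)
    (hext : ∀ n : ℕ, 2 ≤ n → extIsZero M M n) :
    Projective M := by
  by_cases hM : IsZero M
  · exact Projective.of_iso hM.isoZero.symm inferInstance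
  obtain ⟨P, hP⟩ := exists_isFiniteQuasiProjRes_of_qpd_lt_top hM hq
  obtain ⟨mult, ⟨j, hj⟩, hH⟩ := hP.homology_iso
  obtain ⟨a, ha⟩ := hP.bddBelow
  obtain ⟨b, hb⟩ := hP.bddAbove
  have hH' (i : ℤ) : ∃ k, Nonempty (P.homology i ≅ ⨁ fun _ : Fin k => M) := ⟨mult i, hH i⟩
  let Q := projectiveResolution M
  have hB := cocyclesExtend_boundaries Q
    (fun n => cocyclesExtend_of_extIsZero Q (hext (n + 2) (by lia)))
    (fun i => (hQF _).1 (hP.projective i)) hb hH'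
  have := projective_homology Q hP.projective ha hH' (fun i => hB i 0) j
  obtain ⟨e⟩ : Nonempty (P.homology j ≅ ⨁ fun _ : Fin (mult j) => M) := hH j
  let l : Fin (mult j) := ⟨0, Nat.pos_of_ne_zero hj⟩
  exact Retract.projective (Y := P.homology j)
    ⟨biproduct.ι (fun _ : Fin (mult j) => M) l ≫ e.inv,
      e.hom ≫ biproduct.π (fun _ : Fin (mult j) => M) l, by simp⟩
end
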